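/- Let Σ be a finitary signature, I a directed poset, (D_i)_{i∈I} a directed system of quantitative Σ-algebras with nonexpanding homomorphisms f_{ij} : D_i → D_j as connecting maps, and let c_i : D_i → C be a compatible cocone of nonexpanding homomorphisms into a quantitative Σ-algebra C satisfying the colimit conditions: (1) C = ⋃_{i∈I} c_i[D_i] and (2) d_C(c_i(y), c_i(y')) = inf_{j ≥ i} d_{D_j}(f_{ij}(y), f_{ij}(y')) for all i and y, y' ∈ D_i. If a quantitative equation t =_ε t' (with t, t' ∈ T_Σ V for a finite set V of variables and ε ≥ 0) is satisfied by every D_i, then it is satisfied by C. -/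

import Mathlib

open ENNReal NNReal

/-- Σ-terms with variables in `X`, for a finitary signature `Sg`. -/
inductive Term (Sg : ℕ → Type u) (X : Type v) : Type (max u v)
  | var : X → Term Sg X
  | op : ∀ {n : ℕ}, Sg n → (Fin n → Term Sg X) → Term Sg X

/-- The homomorphic extension of a valuation `f : X → A` to terms. -/
def evalT {Sg : ℕ → Type u} {X : Type v} {A : Type w}
    (ops : ∀ n, Sg n → (Fin n → A) → A) (f : X → A) : Term Sg X → A
  | .var x => f x
  | .op σ t => ops _ σ (fun i => evalT ops f (t i))

/-- Homomorphisms commute with the evaluation of terms. -/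
theorem map_evalT {Sg : ℕ → Type u} {X : Type v} {A : Type w} {B : Type x}
    {opsA : ∀ n, Sg n → (Fin n → A) → A} {opsB : ∀ n, Sg n → (Fin n → B) → B} {h : A → B}
    (hh : ∀ n (σ : Sg n) (a : Fin n → A), h (opsA n σ a) = opsB n σ (fun k => h (a k)))
    (g : X → A) (t : Term Sg X) :
    h (evalT opsA g t) = evalT opsB (fun x => h (g x)) t := by
  induction t with
  | var x => rfl
  | op σ t ih => simp only [evalT, hh, ih]

/-- If a cocone of nonexpanding homomorphisms of quantitative `Σ`-algebras
over a directed system satisfies the colimit conditions (collective surjectivity and the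
infimum formula for distances), then every quantitative equation `t =_ε t'` (over a
finite set of variables) satisfied by all algebras of the system is satisfied by the
colimit algebra. -/
theorem directed_colimit_preserves_quantitative_equations.{s, u, v, x}
    {Sg : ℕ → Type s} {I : Type u} [PartialOrder I] [IsDirected I (· ≤ ·)] [Nonempty I]
    (D : I → Type v) [∀ i, EMetricSpace (D i)]
    (opsD : ∀ i, ∀ n, Sg n → (Fin n → D i) → D i)
    (hopsD : ∀ i n (σ : Sg n) (a b : Fin n → D i),
      edist (opsD i n σ a) (opsD i n σ b) ≤ edist a b)
    (f : ∀ i j, i ≤ j → D i → D j)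
    (hf_ne : ∀ i j (h : i ≤ j) (x y : D i), edist (f i j h x) (f i j h y) ≤ edist x y)
    (hf_id : ∀ i (x : D i), f i i le_rfl x = x)
    (hf_comp : ∀ i j k (hij : i ≤ j) (hjk : j ≤ k) (x : D i),
      f j k hjk (f i j hij x) = f i k (hij.trans hjk) x)
    (hf_hom : ∀ i j (h : i ≤ j) n (σ : Sg n) (a : Fin n → D i),
      f i j h (opsD i n σ a) = opsD j n σ (fun k => f i j h (a k)))
    (C : Type v) [EMetricSpace C]
    (opsC : ∀ n, Sg n → (Fin n → C) → C)
    (hopsC : ∀ n (σ : Sg n) (a b : Fin n → C), edist (opsC n σ a) (opsC n σ b) ≤ edist a b)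
    (c : ∀ i, D i → C)
    (hc_ne : ∀ i (x y : D i), edist (c i x) (c i y) ≤ edist x y)
    (hc_compat : ∀ i j (h : i ≤ j) (x : D i), c j (f i j h x) = c i x)
    (hc_hom : ∀ i n (σ : Sg n) (a : Fin n → D i),
      c i (opsD i n σ a) = opsC n σ (fun k => c i (a k)))
    (h1 : ∀ x : C, ∃ i, ∃ y : D i, c i y = x)
    (h2 : ∀ i (y y' : D i), edist (c i y) (c i y') =
      ⨅ j : {j : I // i ≤ j}, edist (f i j.1 j.2 y) (f i j.1 j.2 y'))
    (V : Type x) [Finite V] (t t' : Term Sg V) (ε : ℝ≥0)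
    (hsat : ∀ i (g : V → D i),
      edist (evalT (opsD i) g t) (evalT (opsD i) g t') ≤ (ε : ℝ≥0∞)) :
    ∀ g : V → C, edist (evalT opsC g t) (evalT opsC g t') ≤ (ε : ℝ≥0∞) := by
  intro g
  choose i y hy using fun v => h1 (g v)
  obtain ⟨m, hm⟩ := Finite.exists_le i
  have hg : g = fun v => c m (f (i v) m (hm v) (y v)) := by
    funext v
    rw [hc_compat, hy]
  rw [hg, ← map_evalT (hc_hom m), ← map_evalT (hc_hom m)]
  exact (hc_ne m _ _).trans (hsat m _)
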